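/- Let p, b, f : [-1,1] → ℝ be infinitely differentiable with p(0) = 0, p'(0) < 0, |p'(x)| ≥ |p'(0)|/2 for all x ∈ [-1,1], and b(x) ≥ b₀ > 0 on [-1,1], and suppose λ := -b(0)/p'(0) ∈ (0,1]. Fix boundary values u_L, u_R ∈ ℝ. Then there exists a constant C > 0, independent of ε, such that for every ε ∈ (0,1] and every u ∈ C²([-1,1]) satisfying -ε u''(x) + p(x) u'(x) + b(x) u(x) = f(x) on (-1,1) with u(-1) = u_L and u(1) = u_R, one has |x u'(x)| ≤ C for all x ∈ (-1,1). -/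

import Mathlib

open Set

/-- A function whose derivative satisfies `ε v' = p v - g`, where `p x ≤ -c x` and `|g| ≤ M`, has
`x v x` bounded above on `[a, b]` by any `B > 2M/c` bounding `a v(a)`, if `2ε ≤ c a²`. -/
lemma mul_le_of_attractive {ε c M B a b : ℝ} {v w p g : ℝ → ℝ} (hε : 0 < ε) (ha : 0 < a)
    (haε : 2 * ε ≤ c * a ^ 2) (hc : 0 < c) (hB0 : 0 < B) (hB : 2 * M < c * B)
    (hv : ∀ x ∈ Icc a b, HasDerivAt v (w x) x)
    (heq : ∀ x ∈ Icc a b, ε * w x = p x * v x - g x)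
    (hg : ∀ x ∈ Icc a b, |g x| ≤ M) (hp : ∀ x ∈ Icc a b, p x ≤ -(c * x))
    (hva : a * v a ≤ B) : ∀ x ∈ Icc a b, x * v x ≤ B := by
  have hd : ∀ x ∈ Icc a b, HasDerivAt (fun y => y * v y) (1 * v x + x * w x) x :=
    fun x hx => (hasDerivAt_id x).mul (hv x hx)
  refine image_le_of_deriv_right_lt_deriv_boundary (f := fun y => y * v y)
    (f' := fun x => 1 * v x + x * w x) (B := fun _ => B) (B' := fun _ => 0)
    (fun x hx => (hd x hx).continuousAt.continuousWithinAt)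
    (fun x hx => (hd x ⟨hx.1, hx.2.le⟩).hasDerivWithinAt) hva (fun x => hasDerivAt_const x B) ?_
  intro x hx hxB
  have hx' : x ∈ Icc a b := ⟨hx.1, hx.2.le⟩
  have hx0 : 0 < x := ha.trans_le hx.1
  have hsq : 2 * ε ≤ c * x ^ 2 := haε.trans (by gcongr; exact hx.1)
  have hgx := (abs_le.1 (hg x hx')).1
  have hpx := mul_le_mul_of_nonneg_left (hp x hx') hB0.le
  change x * v x = B at hxB
  change 1 * v x + x * w x < 0
  have hpos : 0 < ε * x := by positivity
  have key : (ε * x) * (1 * v x + x * w x) = ε * B + x * (B * p x) - x ^ 2 * g x := by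
    have h := heq x hx'
    linear_combination x ^ 2 * h + (ε + x * p x) * hxB
  have h1 : x * (B * p x) ≤ x * (B * -(c * x)) := mul_le_mul_of_nonneg_left hpx hx0.le
  have h2 : -(x ^ 2 * g x) ≤ x ^ 2 * M := by nlinarith [sq_nonneg x]
  have h3 : 0 < x ^ 2 * (c * B - 2 * M) := mul_pos (by positivity) (by linarith)
  have h4 := mul_le_mul_of_nonneg_right hsq hB0.le
  have hneg : (ε * x) * (1 * v x + x * w x) < 0 := by rw [key]; nlinarith
  exact (pos_iff_neg_of_mul_neg hneg).1 hpos

/-- The bound `|x u'(x)| ≤ C` to the right of an attractive turning point at `0`. -/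
lemma exists_abs_mul_le_right {c K U M : ℝ} (hc : 0 < c) (hK : 0 ≤ K) (hU : 0 ≤ U) (hM : 0 ≤ M) :
    ∃ C > 0, ∀ (ε : ℝ) (u v w p q g : ℝ → ℝ), ε ∈ Ioc (0 : ℝ) 1 →
      ContinuousOn u (Icc 0 1) →
      (∀ x ∈ Ico (0 : ℝ) 1, HasDerivAt u (v x) x) →
      (∀ x ∈ Ico (0 : ℝ) 1, HasDerivAt v (w x) x) →
      (∀ x ∈ Ico (0 : ℝ) 1, HasDerivAt p (q x) x) →
      (∀ x ∈ Ico (0 : ℝ) 1, ε * w x = p x * v x - g x) →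
      (∀ x ∈ Icc (0 : ℝ) 1, |u x| ≤ U) → (∀ x ∈ Ico (0 : ℝ) 1, |g x| ≤ M) →
      (∀ x ∈ Ico (0 : ℝ) 1, |q x| ≤ K) → (∀ x ∈ Ico (0 : ℝ) 1, |p x| ≤ K * x) →
      (∀ x ∈ Ico (0 : ℝ) 1, p x ≤ -(c * x)) →
      ∀ x ∈ Ico (0 : ℝ) 1, |x * v x| ≤ C := by
  obtain ⟨L, hL0, hL⟩ : ∃ L : ℝ, 0 < L ∧ c * L ^ 2 = 2 :=
    ⟨√(2 / c), by positivity, by rw [Real.sq_sqrt (by positivity)]; field_simp⟩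
  set E : ℝ := 2 * U + K * U + K * L * U + (M + K * U) * (L + 1) with hE
  have hE0 : 0 ≤ E := by positivity
  refine ⟨L * E + 2 * M / c + 1, by positivity, ?_⟩
  intro ε u v w p q g hε hu hv hw hq heq hUx hMx hKx hpK hpc
  obtain ⟨s, hs0, hs⟩ : ∃ s : ℝ, 0 < s ∧ s ^ 2 = ε :=
    ⟨√ε, Real.sqrt_pos.2 hε.1, Real.sq_sqrt hε.1.le⟩
  have hs1 : s ≤ 1 := by
    have := hε.2
    by_contra! h
    nlinarith
  obtain ⟨ξ, hξ, hvξ⟩ : ∃ ξ ∈ Ioo 0 s, v ξ = (u s - u 0) / (s - 0) :=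
    exists_hasDerivAt_eq_slope u v hs0 (hu.mono (Icc_subset_Icc_right hs1))
      fun x hx => hv x ⟨hx.1.le, hx.2.trans_le hs1⟩
  have hξ1 : ξ ∈ Ico (0 : ℝ) 1 := ⟨hξ.1.le, hξ.2.trans_le hs1⟩
  have hεξ : |ε * v ξ| ≤ 2 * U * s := by
    have h1 : ε * v ξ = s * (u s - u 0) := by rw [hvξ, ← hs, sub_zero]; field_simp
    have h2 := hUx s ⟨hs0.le, hs1⟩
    have h3 := hUx 0 ⟨le_rfl, zero_le_one⟩
    rw [h1, abs_mul, abs_of_pos hs0]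
    have := abs_sub (u s) (u 0)
    nlinarith
  have hpu : ∀ y ∈ Ico (0 : ℝ) 1, |p y * u y| ≤ K * y * U := fun y hy => by
    rw [abs_mul]
    exact mul_le_mul (hpK y hy) (hUx y ⟨hy.1, hy.2.le⟩) (abs_nonneg _) (mul_nonneg hK hy.1)
  have near : ∀ x ∈ Ico (0 : ℝ) 1, x ≤ L * s → |x * v x| ≤ L * E := by
    intro x hx hxL
    have hlip : ‖(ε * v x - p x * u x) - (ε * v ξ - p ξ * u ξ)‖ ≤ (M + K * U) * ‖x - ξ‖ := by
      refine (convex_Ico (0 : ℝ) 1).norm_image_sub_le_of_norm_hasDerivWithin_le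
        (f := fun y => ε * v y - p y * u y)
        (f' := fun y => ε * w y - (q y * u y + p y * v y)) ?_ ?_ hξ1 hx
      · intro y hy
        exact (((hw y hy).const_mul ε).sub ((hq y hy).mul (hv y hy))).hasDerivWithinAt
      · intro y hy
        have h : ε * w y - (q y * u y + p y * v y) = -(g y + q y * u y) := by
          rw [heq y hy]; ring
        rw [h, norm_neg]
        refine (norm_add_le _ _).trans (add_le_add (hMx y hy) ?_)
        rw [norm_mul]
        exact mul_le_mul (hKx y hy) (hUx y ⟨hy.1, hy.2.le⟩) (abs_nonneg _) hK
    rw [Real.norm_eq_abs, Real.norm_eq_abs] at hlip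
    have hdist : |x - ξ| ≤ (L + 1) * s := by
      have := hx.1
      have := hξ.1
      have := hξ.2
      rw [abs_le]
      constructor <;> nlinarith
    have h1 : (M + K * U) * |x - ξ| ≤ (M + K * U) * ((L + 1) * s) := by gcongr
    have h2 : K * x * U ≤ K * (L * s) * U := by gcongr
    have h3 : K * ξ * U ≤ K * s * U := by have := hξ.2.le; gcongr
    have h4 := hpu x hx
    have h5 := hpu ξ hξ1
    have hεx : |ε * v x| ≤ E * s := by
      rw [abs_le] at *
      rw [hE]
      constructor <;> linarith
    rw [abs_mul, abs_of_pos hε.1] at hεx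
    rw [abs_mul, abs_of_nonneg hx.1]
    have h6 : ε * (x * |v x|) ≤ ε * (L * E) := calc
      ε * (x * |v x|) = x * (ε * |v x|) := by ring
      _ ≤ (L * s) * (E * s) :=
        mul_le_mul hxL hεx (mul_nonneg hε.1.le (abs_nonneg _)) (by positivity)
      _ = ε * (L * E) := by rw [← hs]; ring
    exact le_of_mul_le_mul_left h6 hε.1
  intro x hx
  have hMc : 0 ≤ 2 * M / c := by positivity
  rcases le_total x (L * s) with hxL | hxL
  · exact (near x hx hxL).trans (by linarith)
  have ha : 0 < L * s := by positivity
  have hsub : ∀ y ∈ Icc (L * s) x, y ∈ Ico (0 : ℝ) 1 :=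
    fun y hy => ⟨ha.le.trans hy.1, hy.2.trans_lt hx.2⟩
  have hstart := abs_le.1 (near (L * s) (hsub _ ⟨le_rfl, hxL⟩) le_rfl)
  have haε : 2 * ε ≤ c * (L * s) ^ 2 := by rw [mul_pow, ← mul_assoc, hL, hs]
  have hB0 : 0 < L * E + 2 * M / c + 1 := by positivity
  have hB : 2 * M < c * (L * E + 2 * M / c + 1) := by
    have h : c * (L * E + 2 * M / c + 1) = 2 * M + c * (L * E) + c := by field_simp; ring
    have : 0 ≤ c * (L * E) := by positivity
    linarith
  refine abs_le.2 ⟨?_, ?_⟩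
  · have := mul_le_of_attractive (v := fun y => -v y) (w := fun y => -w y) (g := fun y => -g y)
      hε.1 ha haε hc hB0 hB (fun y hy => (hw y (hsub y hy)).neg)
      (fun y hy => by linear_combination -(heq y (hsub y hy)))
      (fun y hy => by rw [abs_neg]; exact hMx y (hsub y hy))
      (fun y hy => hpc y (hsub y hy)) (by linarith) x ⟨hxL, le_rfl⟩
    linarith
  · exact mul_le_of_attractive hε.1 ha haε hc hB0 hB (fun y hy => hw y (hsub y hy))
      (fun y hy => heq y (hsub y hy)) (fun y hy => hMx y (hsub y hy))
      (fun y hy => hpc y (hsub y hy)) (by linarith) x ⟨hxL, le_rfl⟩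

/-- At an interior local maximum the second derivative is nonpositive. -/
lemma deriv_deriv_nonpos_of_isLocalMax {u : ℝ → ℝ} {x : ℝ} (h : IsLocalMax u x)
    (hc : ContinuousAt u x) : deriv (deriv u) x ≤ 0 := by
  by_contra! hpos
  have hmin := isLocalMin_of_deriv_deriv_pos hpos h.deriv_eq_zero hc
  have hconst : u =ᶠ[nhds x] fun _ => u x := by
    filter_upwards [h, hmin] with y hy hy'
    exact le_antisymm hy hy'
  have : deriv (deriv u) x = 0 := by
    rw [hconst.deriv.deriv_eq]; simp
  exact hpos.ne' this

/-- One-sided maximum principle for `-ε u'' + p u' + b u = f`. -/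
lemma le_of_maximum_principle {ε A b₀ : ℝ} {u p b f : ℝ → ℝ} (hε : 0 < ε) (hb₀ : 0 < b₀)
    (hA : 0 ≤ A) (hu : ContinuousOn u (Icc (-1) 1))
    (heq : ∀ x ∈ Ioo (-1 : ℝ) 1,
      -ε * deriv (deriv u) x + p x * deriv u x + b x * u x = f x)
    (hb : ∀ x ∈ Ioo (-1 : ℝ) 1, b₀ ≤ b x) (hf : ∀ x ∈ Ioo (-1 : ℝ) 1, f x ≤ b₀ * A)
    (hL : u (-1) ≤ A) (hR : u 1 ≤ A) : ∀ x ∈ Icc (-1 : ℝ) 1, u x ≤ A := by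
  obtain ⟨z, hz, hmax⟩ := isCompact_Icc.exists_isMaxOn (nonempty_Icc.2 (by norm_num)) hu
  suffices u z ≤ A from fun x hx => (hmax hx).trans this
  rcases eq_endpoints_or_mem_Ioo_of_mem_Icc hz with rfl | rfl | hz'
  · exact hL
  · exact hR
  have hnhds := Icc_mem_nhds hz'.1 hz'.2
  have hloc : IsLocalMax u z := hmax.isLocalMax hnhds
  have h2 := deriv_deriv_nonpos_of_isLocalMax hloc (hu.continuousAt hnhds)
  have h := heq z hz'
  rw [hloc.deriv_eq_zero] at h
  by_contra! hlt
  have h3 := hf z hz'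
  have h4 := mul_le_mul_of_nonneg_right (hb z hz') (hA.trans hlt.le)
  have h5 := mul_lt_mul_of_pos_left hlt hb₀
  have h6 := mul_nonneg_of_nonpos_of_nonpos (neg_nonpos.2 hε.le) h2
  linarith

/-- Two-sided maximum principle for `-ε u'' + p u' + b u = f`. -/
lemma abs_le_of_maximum_principle {ε A b₀ : ℝ} {u p b f : ℝ → ℝ} (hε : 0 < ε) (hb₀ : 0 < b₀)
    (hA : 0 ≤ A) (hu : ContinuousOn u (Icc (-1) 1))
    (heq : ∀ x ∈ Ioo (-1 : ℝ) 1,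
      -ε * deriv (deriv u) x + p x * deriv u x + b x * u x = f x)
    (hb : ∀ x ∈ Ioo (-1 : ℝ) 1, b₀ ≤ b x) (hf : ∀ x ∈ Ioo (-1 : ℝ) 1, |f x| ≤ b₀ * A)
    (hL : |u (-1)| ≤ A) (hR : |u 1| ≤ A) : ∀ x ∈ Icc (-1 : ℝ) 1, |u x| ≤ A := by
  intro x hx
  have h1 : deriv (fun y => -u y) = fun y => -deriv u y := by
    funext y; exact deriv.fun_neg
  have h2 := le_of_maximum_principle (u := fun y => -u y) (p := p) (b := b) (f := fun y => -f y)
    hε hb₀ hA hu.neg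
    (fun y hy => by
      rw [h1, deriv.fun_neg]
      linear_combination -(heq y hy))
    hb (fun y hy => (neg_le_abs _).trans (hf y hy)) ((neg_le_abs _).trans hL)
    ((neg_le_abs _).trans hR) x hx
  have h3 := le_of_maximum_principle hε hb₀ hA hu heq hb
    (fun y hy => (le_abs_self _).trans (hf y hy)) ((le_abs_self _).trans hL)
    ((le_abs_self _).trans hR) x hx
  exact abs_le.2 ⟨by linarith, h3⟩

/-- A continuous function on `(-1, 1)`, negative at `0` and bounded away from zero by `c`, is at
most `-c`. -/
lemma le_neg_of_le_abs {q : ℝ → ℝ} {c : ℝ} (hc : 0 < c) (hq : ContinuousOn q (Ioo (-1) 1))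
    (h0 : q 0 < 0) (habs : ∀ x ∈ Ioo (-1 : ℝ) 1, c ≤ |q x|) :
    ∀ x ∈ Ioo (-1 : ℝ) 1, q x ≤ -c := by
  intro x hx
  have hneg : q x < 0 := by
    by_contra! h
    obtain ⟨y, hy, hy0⟩ := isPreconnected_Ioo.intermediate_value
      (show (0 : ℝ) ∈ Ioo (-1 : ℝ) 1 by norm_num) hx hq ⟨h0.le, h⟩
    have := habs y hy
    rw [hy0, abs_zero] at this
    linarith
  have := habs x hx
  rw [abs_of_neg hneg] at this
  linarith

lemma hasDerivAt_comp_neg {h : ℝ → ℝ} {h' x : ℝ} (hh : HasDerivAt h h' (-x)) :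
    HasDerivAt (fun y => h (-y)) (-h') x := by
  simpa using HasDerivAt.comp_const_sub 0 x (f := h) (f' := h') (by simpa using hh)

/-- If `p 0 = 0` and `p' ≤ -c` on `[0, 1)`, then `p x ≤ -c x` there. -/
lemma le_neg_mul_of_deriv_le {p q : ℝ → ℝ} {c : ℝ} (hp0 : p 0 = 0)
    (hp : ∀ x ∈ Ico (0 : ℝ) 1, HasDerivAt p (q x) x) (hq : ∀ x ∈ Ico (0 : ℝ) 1, q x ≤ -c) :
    ∀ x ∈ Ico (0 : ℝ) 1, p x ≤ -(c * x) := by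
  intro x hx
  have hsub : ∀ y ∈ Icc 0 x, y ∈ Ico (0 : ℝ) 1 := fun y hy => ⟨hy.1, hy.2.trans_lt hx.2⟩
  refine image_le_of_deriv_right_le_deriv_boundary (f := p) (f' := q)
    (B := fun y => -(c * y)) (B' := fun _ => -(c * 1)) (a := 0) (b := x)
    (fun y hy => (hp y (hsub y hy)).continuousAt.continuousWithinAt)
    (fun y hy => (hp y (hsub y ⟨hy.1, hy.2.le⟩)).hasDerivWithinAt)
    (by simp [hp0]) (by fun_prop)
    (fun y _ => ((hasDerivAt_id y).const_mul c).neg.hasDerivWithinAt)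
    (fun y hy => by rw [mul_one]; exact hq y (hsub y ⟨hy.1, hy.2.le⟩)) ⟨hx.1, le_rfl⟩

/-- If `p 0 = 0` and `|p'| ≤ K` on `[0, 1)`, then `|p x| ≤ K x` there. -/
lemma abs_le_mul_of_abs_deriv_le {p q : ℝ → ℝ} {K : ℝ} (hp0 : p 0 = 0)
    (hp : ∀ x ∈ Ico (0 : ℝ) 1, HasDerivAt p (q x) x) (hq : ∀ x ∈ Ico (0 : ℝ) 1, |q x| ≤ K) :
    ∀ x ∈ Ico (0 : ℝ) 1, |p x| ≤ K * x := by
  intro x hx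
  have := (convex_Ico (0 : ℝ) 1).norm_image_sub_le_of_norm_hasDerivWithin_le
    (fun y hy => (hp y hy).hasDerivWithinAt) hq ⟨le_rfl, zero_lt_one⟩ hx
  simpa [hp0, abs_of_nonneg hx.1] using this

/-- Cusp-like interior layer: for the attractive interior turning point problem
`-ε u'' + p u' + b u = f` on `(-1,1)` with `p(0)=0`, `p'(0)<0`,
`|p'(x)| ≥ |p'(0)|/2`, `b ≥ b₀ > 0` and `λ = -b(0)/p'(0) ∈ (0,1]`,
the bound `|x u'(x)| ≤ C` holds uniformly in `ε ∈ (0,1]`. -/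
theorem stmt1 (p b f : ℝ → ℝ) (b₀ : ℝ) (hb₀ : 0 < b₀)
    (hp : ContDiffOn ℝ (⊤ : ℕ∞) p (Icc (-1 : ℝ) 1))
    (hb : ContDiffOn ℝ (⊤ : ℕ∞) b (Icc (-1 : ℝ) 1))
    (hf : ContDiffOn ℝ (⊤ : ℕ∞) f (Icc (-1 : ℝ) 1))
    (hp0 : p 0 = 0) (hp'0 : deriv p 0 < 0)
    (hp'lb : ∀ x ∈ Icc (-1 : ℝ) 1, |deriv p 0| / 2 ≤ |deriv p x|)
    (hblb : ∀ x ∈ Icc (-1 : ℝ) 1, b₀ ≤ b x)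
    (hlam : -(b 0) / deriv p 0 ∈ Ioc (0 : ℝ) 1)
    (uL uR : ℝ) :
    ∃ C > 0, ∀ ε ∈ Ioc (0 : ℝ) 1, ∀ u : ℝ → ℝ,
      ContDiffOn ℝ 2 u (Icc (-1 : ℝ) 1) →
      (∀ x ∈ Ioo (-1 : ℝ) 1,
        -ε * deriv (deriv u) x + p x * deriv u x + b x * u x = f x) →
      u (-1) = uL → u 1 = uR →
      ∀ x ∈ Ioo (-1 : ℝ) 1, |x * deriv u x| ≤ C := by
  set c : ℝ := |deriv p 0| / 2 with hcdef
  have hc : 0 < c := by have := abs_pos.2 hp'0.ne; positivity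
  have hIoo : ∀ x ∈ Ioo (-1 : ℝ) 1, Icc (-1 : ℝ) 1 ∈ nhds x := fun x hx => Icc_mem_nhds hx.1 hx.2
  have hpd : ∀ x ∈ Ioo (-1 : ℝ) 1, HasDerivAt p (deriv p x) x := fun x hx =>
    ((hp.contDiffAt (hIoo x hx)).differentiableAt (by simp)).hasDerivAt
  have hdw : ContinuousOn (derivWithin p (Icc (-1) 1)) (Icc (-1) 1) :=
    hp.continuousOn_derivWithin (uniqueDiffOn_Icc (by norm_num)) (by simp)
  have hdeq : ∀ x ∈ Ioo (-1 : ℝ) 1, deriv p x = derivWithin p (Icc (-1) 1) x := fun x hx =>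
    (derivWithin_of_mem_nhds (hIoo x hx)).symm
  have hdc : ContinuousOn (deriv p) (Ioo (-1) 1) := (hdw.mono Ioo_subset_Icc_self).congr hdeq
  have hdle := le_neg_of_le_abs hc hdc hp'0 fun x hx => hp'lb x (Ioo_subset_Icc_self hx)
  obtain ⟨K, hK⟩ := isCompact_Icc.exists_bound_of_continuousOn hdw
  obtain ⟨F, hF⟩ := isCompact_Icc.exists_bound_of_continuousOn hf.continuousOn
  obtain ⟨β, hβ⟩ := isCompact_Icc.exists_bound_of_continuousOn hb.continuousOn
  have h0mem : (0 : ℝ) ∈ Icc (-1 : ℝ) 1 := by norm_num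
  have hK0 : 0 ≤ K := (norm_nonneg _).trans (hK 0 h0mem)
  have hF0 : 0 ≤ F := (norm_nonneg _).trans (hF 0 h0mem)
  have hβ0 : 0 ≤ β := (norm_nonneg _).trans (hβ 0 h0mem)
  have hdK : ∀ x ∈ Ioo (-1 : ℝ) 1, |deriv p x| ≤ K := fun x hx => by
    rw [hdeq x hx]; exact hK x (Ioo_subset_Icc_self hx)
  set U : ℝ := F / b₀ + |uL| + |uR| with hUdef
  have hFb : 0 ≤ F / b₀ := by positivity
  have hU0 : 0 ≤ U := by positivity
  have hFU : F ≤ b₀ * U := calc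
    F = b₀ * (F / b₀) := by field_simp
    _ ≤ b₀ * U := by gcongr; linarith [abs_nonneg uL, abs_nonneg uR]
  obtain ⟨C, hC0, hC⟩ := exists_abs_mul_le_right (M := F + β * U) hc hK0 hU0 (by positivity)
  refine ⟨C, hC0, fun ε hε u hu heq hL hR => ?_⟩
  have hud : ∀ x ∈ Ioo (-1 : ℝ) 1, HasDerivAt u (deriv u x) x := fun x hx =>
    ((hu.contDiffAt (hIoo x hx)).differentiableAt (by simp)).hasDerivAt
  have hud2 : ∀ x ∈ Ioo (-1 : ℝ) 1, HasDerivAt (deriv u) (deriv (deriv u) x) x := fun x hx =>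
    ((((hu.mono Ioo_subset_Icc_self).deriv_of_isOpen (m := 1) isOpen_Ioo (by norm_num)).contDiffAt
      (isOpen_Ioo.mem_nhds hx)).differentiableAt (by simp)).hasDerivAt
  have hUx := abs_le_of_maximum_principle hε.1 hb₀ hU0 hu.continuousOn heq
    (fun x hx => hblb x (Ioo_subset_Icc_self hx))
    (fun x hx => (hF x (Ioo_subset_Icc_self hx)).trans hFU)
    (by rw [hL]; linarith [abs_nonneg uL, abs_nonneg uR])
    (by rw [hR]; linarith [abs_nonneg uL, abs_nonneg uR])
  have hg : ∀ x ∈ Icc (-1 : ℝ) 1, |f x - b x * u x| ≤ F + β * U := fun x hx => by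
    refine (abs_sub _ _).trans (add_le_add (hF x hx) ?_)
    rw [abs_mul]
    exact mul_le_mul (hβ x hx) (hUx x hx) (abs_nonneg _) hβ0
  have hpos : ∀ x ∈ Ico (0 : ℝ) 1, x ∈ Ioo (-1 : ℝ) 1 := fun x hx => ⟨by linarith [hx.1], hx.2⟩
  have hneg : ∀ x ∈ Ico (0 : ℝ) 1, -x ∈ Ioo (-1 : ℝ) 1 := fun x hx =>
    ⟨by linarith [hx.2], by linarith [hx.1]⟩
  have hnegc : ∀ x ∈ Icc (0 : ℝ) 1, -x ∈ Icc (-1 : ℝ) 1 := fun x hx =>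
    ⟨by linarith [hx.2], by linarith [hx.1]⟩
  intro x hx
  rcases le_total 0 x with hx0 | hx0
  · refine hC ε u (deriv u) (deriv (deriv u)) p (deriv p) (fun y => f y - b y * u y) hε
      (hu.continuousOn.mono (Icc_subset_Icc_left (by norm_num)))
      (fun y hy => hud y (hpos y hy)) (fun y hy => hud2 y (hpos y hy))
      (fun y hy => hpd y (hpos y hy)) (fun y hy => by linear_combination -(heq y (hpos y hy)))
      (fun y hy => hUx y ⟨by linarith [hy.1], hy.2⟩)
      (fun y hy => hg y (Ioo_subset_Icc_self (hpos y hy))) (fun y hy => hdK y (hpos y hy))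
      (abs_le_mul_of_abs_deriv_le hp0 (fun y hy => hpd y (hpos y hy))
        fun y hy => hdK y (hpos y hy))
      (le_neg_mul_of_deriv_le hp0 (fun y hy => hpd y (hpos y hy))
        fun y hy => hdle y (hpos y hy)) x ⟨hx0, hx.2⟩
  · have hpd' : ∀ y ∈ Ico (0 : ℝ) 1, HasDerivAt (fun z => -p (-z)) (deriv p (-y)) y :=
      fun y hy => by simpa using (hasDerivAt_comp_neg (hpd (-y) (hneg y hy))).fun_neg
    have h := hC ε (fun y => u (-y)) (fun y => -deriv u (-y)) (fun y => deriv (deriv u) (-y))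
      (fun y => -p (-y)) (fun y => deriv p (-y)) (fun y => f (-y) - b (-y) * u (-y)) hε
      (hu.continuousOn.comp continuousOn_neg hnegc)
      (fun y hy => hasDerivAt_comp_neg (hud (-y) (hneg y hy)))
      (fun y hy => by simpa using (hasDerivAt_comp_neg (hud2 (-y) (hneg y hy))).fun_neg)
      hpd' (fun y hy => by linear_combination -(heq (-y) (hneg y hy)))
      (fun y hy => hUx (-y) (hnegc y hy))
      (fun y hy => hg (-y) (Ioo_subset_Icc_self (hneg y hy)))
      (fun y hy => hdK (-y) (hneg y hy))
      (abs_le_mul_of_abs_deriv_le (by simp [hp0]) hpd' fun y hy => hdK (-y) (hneg y hy))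
      (le_neg_mul_of_deriv_le (by simp [hp0]) hpd' fun y hy => hdle (-y) (hneg y hy))
      (-x) ⟨by linarith, by linarith [hx.1]⟩
    simpa using h
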